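/- Let (b,c) be a connected graph over a countably infinite set X. Then the following are equivalent: (i) D₀ ⊆ C₀(X) (uniform transience); (ii) there exists C ≥ 0 with ‖φ‖_∞ ≤ C · Q(φ)^{1/2} for all φ ∈ C_c(X); (ii') for one (equivalently, for all) o ∈ X there exists C_o ≥ 0 with ‖φ‖_∞ ≤ C_o · ‖φ‖_o for all φ ∈ C_c(X). -/

import Mathlib

open ENNReal Filter Topology

namespace UTGraph

variable {X : Type*}

/-- A graph over `X`: symmetric nonnegative edge weight `b` with zero diagonal and
summable rows, together with a nonnegative potential (killing term) `c`. -/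
structure IsGraph (b : X → X → ℝ) (c : X → ℝ) : Prop where
  symm : ∀ x y, b x y = b y x
  nonneg : ∀ x y, 0 ≤ b x y
  loopless : ∀ x, b x x = 0
  row_summable : ∀ x, Summable fun y => b x y
  c_nonneg : ∀ x, 0 ≤ c x

/-- Connectedness: any two vertices are joined by a path of positive edge weights. -/
def Connected (b : X → X → ℝ) : Prop :=
  ∀ x y : X, Relation.ReflTransGen (fun u v => 0 < b u v) x y

/-- The energy form `Q(f)`, with values in `[0,∞]`. -/
noncomputable def energy (b : X → X → ℝ) (c : X → ℝ) (f : X → ℝ) : ℝ≥0∞ :=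
  (1 / 2) * ∑' p : X × X, ENNReal.ofReal (b p.1 p.2 * (f p.1 - f p.2) ^ 2)
    + ∑' x, ENNReal.ofReal (c x * f x ^ 2)

/-- `f` has finite energy, i.e. `f ∈ D`. -/
def FiniteEnergy (b : X → X → ℝ) (c : X → ℝ) (f : X → ℝ) : Prop :=
  energy b c f < ⊤

/-- The bilinear energy form `Q(f,g)` (for finite-energy functions). -/
noncomputable def energyBilin (b : X → X → ℝ) (c : X → ℝ) (f g : X → ℝ) : ℝ :=
  (1 / 2) * ∑' p : X × X, b p.1 p.2 * (f p.1 - f p.2) * (g p.1 - g p.2)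
    + ∑' x, c x * f x * g x

/-- `f ∈ C_c(X)`: finitely supported function. -/
def FinSupp (f : X → ℝ) : Prop := (Function.support f).Finite

/-- The norm `‖f‖_o = (Q(f) + f(o)²)^{1/2}`. -/
noncomputable def normO (b : X → X → ℝ) (c : X → ℝ) (o : X) (f : X → ℝ) : ℝ :=
  Real.sqrt ((energy b c f).toReal + f o ^ 2)

/-- `f ∈ D₀`: there is a sequence of finitely supported functions converging to `f`
pointwise whose energy difference to `f` tends to `0`. -/
def MemD0 (b : X → X → ℝ) (c : X → ℝ) (f : X → ℝ) : Prop :=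
  ∃ φ : ℕ → X → ℝ, (∀ n, FinSupp (φ n)) ∧
    (∀ x, Tendsto (fun n => φ n x) atTop (𝓝 (f x))) ∧
    Tendsto (fun n => energy b c (φ n - f)) atTop (𝓝 0)

/-- `f ∈ C₀(X)`: `f` belongs to the uniform closure of the finitely supported functions,
i.e. for every `ε > 0` the set where `|f| ≥ ε` is finite. -/
def MemC0 (f : X → ℝ) : Prop := ∀ ε : ℝ, 0 < ε → {x | ε ≤ |f x|}.Finite

/-- The graph is uniformly transient: `D₀ ⊆ C₀(X)`. -/
def UniformlyTransient (b : X → X → ℝ) (c : X → ℝ) : Prop :=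
  ∀ f : X → ℝ, MemD0 b c f → MemC0 f

/-- The capacity of a point: `cap(x) = inf {Q(φ) : φ ∈ C_c(X), φ(x) = 1}`. -/
noncomputable def cap (b : X → X → ℝ) (c : X → ℝ) (x : X) : ℝ≥0∞ :=
  ⨅ (φ : X → ℝ) (_ : FinSupp φ) (_ : φ x = 1), energy b c φ

/-- `f ∈ F`: the domain of the formal Laplacian. -/
def MemF (b : X → X → ℝ) (f : X → ℝ) : Prop :=
  ∀ x, Summable fun y => b x y * |f y|

/-- The formal Laplacian `𝓛 f (x) = Σ_y b(x,y)(f(x) - f(y)) + c(x) f(x)`. -/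
noncomputable def formalLaplacian (b : X → X → ℝ) (c : X → ℝ) (f : X → ℝ) (x : X) : ℝ :=
  (∑' y, b x y * (f x - f y)) + c x * f x

/-- `f` is harmonic: `f ∈ F` and `𝓛 f = 0`. -/
def Harmonic (b : X → X → ℝ) (c : X → ℝ) (f : X → ℝ) : Prop :=
  MemF b f ∧ ∀ x, formalLaplacian b c f x = 0

/-- The graph is recurrent: the constant function `1` lies in `D₀` and `Q(1) = 0`. -/
def Recurrent (b : X → X → ℝ) (c : X → ℝ) : Prop :=
  MemD0 b c 1 ∧ energy b c 1 = 0

/-- The graph is transient: not recurrent. -/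
def Transient (b : X → X → ℝ) (c : X → ℝ) : Prop := ¬ Recurrent b c

/-- The metric `γ_o`. -/
noncomputable def gammaO (b : X → X → ℝ) (c : X → ℝ) (o x y : X) : ℝ :=
  sSup {d : ℝ | ∃ φ : X → ℝ, FinSupp φ ∧
    energy b c φ + ENNReal.ofReal (φ o ^ 2) ≤ 1 ∧ d = |φ x - φ y|}

/-- The metric `γ`. -/
noncomputable def gamma (b : X → X → ℝ) (c : X → ℝ) (x y : X) : ℝ :=
  sSup {d : ℝ | ∃ φ : X → ℝ, FinSupp φ ∧ energy b c φ ≤ 1 ∧ d = |φ x - φ y|}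

/-- `d` is a metric on `X`. -/
def IsMetric (d : X → X → ℝ) : Prop :=
  (∀ x y, 0 ≤ d x y) ∧ (∀ x y, d x y = d y x) ∧
  (∀ x y, d x y = 0 ↔ x = y) ∧ (∀ x y z, d x z ≤ d x y + d y z)

/-- `f` belongs to the closure of `C_c(X)` with respect to the norm
`‖·‖_Q = (Q(·) + ‖·‖_m²)^{1/2}` inside `D ∩ ℓ²(X,m)`. -/
def MemFormDomain (b : X → X → ℝ) (c : X → ℝ) (m : X → ℝ) (f : X → ℝ) : Prop :=
  FiniteEnergy b c f ∧ Summable (fun x => m x * f x ^ 2) ∧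
  ∃ φ : ℕ → X → ℝ, (∀ n, FinSupp (φ n)) ∧
    Tendsto (fun n => energy b c (f - φ n)
      + ∑' x, ENNReal.ofReal (m x * (f x - φ n x) ^ 2)) atTop (𝓝 0)

end UTGraph

namespace UTGraph

variable {X : Type*} {b : X → X → ℝ} {c : X → ℝ}

lemma energy_smul (a : ℝ) (f : X → ℝ) :
    energy b c (a • f) = ENNReal.ofReal (a ^ 2) * energy b c f := by
  have hedge (p : X × X) : ENNReal.ofReal (b p.1 p.2 * ((a • f) p.1 - (a • f) p.2) ^ 2) =
      ENNReal.ofReal (a ^ 2) * ENNReal.ofReal (b p.1 p.2 * (f p.1 - f p.2) ^ 2) := by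
    rw [← ENNReal.ofReal_mul (sq_nonneg a)]
    congr 1
    simp only [Pi.smul_apply, smul_eq_mul]
    ring
  have hkill (x : X) : ENNReal.ofReal (c x * (a • f) x ^ 2) =
      ENNReal.ofReal (a ^ 2) * ENNReal.ofReal (c x * f x ^ 2) := by
    rw [← ENNReal.ofReal_mul (sq_nonneg a)]
    congr 1
    simp only [Pi.smul_apply, smul_eq_mul]
    ring
  simp only [energy, hedge, hkill, ENNReal.tsum_mul_left]
  ring

lemma energy_neg (f : X → ℝ) : energy b c (-f) = energy b c f := by
  simpa using energy_smul (b := b) (c := c) (-1) f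

lemma energy_add_le (h : IsGraph b c) (f g : X → ℝ) :
    energy b c (f + g) ≤ 2 * (energy b c f + energy b c g) := by
  have key (w s t : ℝ) (hw : 0 ≤ w) : ENNReal.ofReal (w * (s + t) ^ 2) ≤
      2 * (ENNReal.ofReal (w * s ^ 2) + ENNReal.ofReal (w * t ^ 2)) := by
    rw [← ENNReal.ofReal_add (by positivity) (by positivity),
      ← ENNReal.ofReal_ofNat 2, ← ENNReal.ofReal_mul (by norm_num)]
    apply ENNReal.ofReal_le_ofReal
    nlinarith [mul_nonneg hw (sq_nonneg (s - t))]
  have hedge : ∑' p : X × X, ENNReal.ofReal (b p.1 p.2 * ((f + g) p.1 - (f + g) p.2) ^ 2) ≤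
      2 * (∑' p : X × X, ENNReal.ofReal (b p.1 p.2 * (f p.1 - f p.2) ^ 2) +
        ∑' p : X × X, ENNReal.ofReal (b p.1 p.2 * (g p.1 - g p.2) ^ 2)) := by
    rw [← ENNReal.tsum_add, ← ENNReal.tsum_mul_left]
    refine ENNReal.tsum_le_tsum fun p => ?_
    rw [Pi.add_apply, Pi.add_apply, add_sub_add_comm]
    exact key _ _ _ (h.nonneg _ _)
  have hkill : ∑' x, ENNReal.ofReal (c x * (f + g) x ^ 2) ≤
      2 * (∑' x, ENNReal.ofReal (c x * f x ^ 2) + ∑' x, ENNReal.ofReal (c x * g x ^ 2)) := by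
    rw [← ENNReal.tsum_add, ← ENNReal.tsum_mul_left]
    exact ENNReal.tsum_le_tsum fun x => key _ _ _ (h.c_nonneg x)
  calc energy b c (f + g) ≤ _ := add_le_add (mul_le_mul_right hedge _) hkill
    _ = _ := by simp only [energy]; ring

lemma energy_sub_le (h : IsGraph b c) (f g : X → ℝ) :
    energy b c (f - g) ≤ 2 * (energy b c f + energy b c g) := by
  simpa [sub_eq_add_neg, energy_neg] using energy_add_le h f (-g)

lemma energy_abs_le (h : IsGraph b c) (f : X → ℝ) : energy b c |f| ≤ energy b c f := by
  refine add_le_add (mul_le_mul_right (ENNReal.tsum_le_tsum fun p => ?_) _)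
    (ENNReal.tsum_le_tsum fun x => ?_)
  · exact ENNReal.ofReal_le_ofReal (mul_le_mul_of_nonneg_left
      (sq_le_sq.mpr (abs_abs_sub_abs_le (f p.1) (f p.2))) (h.nonneg _ _))
  · rw [Pi.abs_apply, sq_abs]

lemma lowerSemicontinuous_energy : LowerSemicontinuous (energy b c) := by
  unfold energy
  refine LowerSemicontinuous.add ?_ ?_
  · simp_rw [← ENNReal.tsum_mul_left]
    refine lowerSemicontinuous_tsum fun p => Continuous.lowerSemicontinuous ?_
    exact (ENNReal.continuous_const_mul (by norm_num)).comp
      (ENNReal.continuous_ofReal.comp (by fun_prop))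
  · refine lowerSemicontinuous_tsum fun x => Continuous.lowerSemicontinuous ?_
    exact ENNReal.continuous_ofReal.comp (by fun_prop)

lemma energy_le_of_tendsto {f : ℕ → X → ℝ} {g : X → ℝ} {M : ℝ≥0∞}
    (hlim : Tendsto f atTop (𝓝 g)) (hM : ∀ n, energy b c (f n) ≤ M) : energy b c g ≤ M :=
  (lowerSemicontinuous_energy.isClosed_preimage M).mem_of_tendsto hlim (Eventually.of_forall hM)

lemma FinSupp.energy_ne_top (h : IsGraph b c) {f : X → ℝ} (hf : FinSupp f) :
    energy b c f ≠ ⊤ := by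
  unfold FinSupp at hf
  have hrow : ∑' p : X × X, ENNReal.ofReal (b p.1 p.2 * f p.1 ^ 2) ≠ ⊤ := by
    rw [ENNReal.tsum_prod (f := fun x y => ENNReal.ofReal (b x y * f x ^ 2))]
    have hx (x : X) : ∑' y, ENNReal.ofReal (b x y * f x ^ 2) =
        ENNReal.ofReal (∑' y, b x y * f x ^ 2) :=
      (ENNReal.ofReal_tsum_of_nonneg (fun y => mul_nonneg (h.nonneg x y) (sq_nonneg _))
        ((h.row_summable x).mul_right _)).symm
    simp only [hx]
    rw [tsum_eq_sum (s := hf.toFinset) fun x hx => by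
      have hx0 : f x = 0 := by simpa using hx
      simp [hx0]]
    exact (ENNReal.sum_lt_top.mpr fun _ _ => ENNReal.ofReal_lt_top).ne
  have hcol : ∑' p : X × X, ENNReal.ofReal (b p.1 p.2 * f p.2 ^ 2) ≠ ⊤ := by
    rw [← (Equiv.prodComm X X).tsum_eq]
    simpa [h.symm] using hrow
  have hedge : ∑' p : X × X, ENNReal.ofReal (b p.1 p.2 * (f p.1 - f p.2) ^ 2) ≤
      2 * (∑' p : X × X, ENNReal.ofReal (b p.1 p.2 * f p.1 ^ 2) +
        ∑' p : X × X, ENNReal.ofReal (b p.1 p.2 * f p.2 ^ 2)) := by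
    rw [← ENNReal.tsum_add, ← ENNReal.tsum_mul_left]
    refine ENNReal.tsum_le_tsum fun p => ?_
    have hw := h.nonneg p.1 p.2
    rw [← ENNReal.ofReal_add (by positivity) (by positivity),
      ← ENNReal.ofReal_ofNat 2, ← ENNReal.ofReal_mul (by norm_num)]
    apply ENNReal.ofReal_le_ofReal
    nlinarith [mul_nonneg hw (sq_nonneg (f p.1 + f p.2))]
  have hkill : ∑' x, ENNReal.ofReal (c x * f x ^ 2) ≠ ⊤ := by
    rw [tsum_eq_sum (s := hf.toFinset) fun x hx => by
      have hx0 : f x = 0 := by simpa using hx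
      simp [hx0]]
    exact (ENNReal.sum_lt_top.mpr fun _ _ => ENNReal.ofReal_lt_top).ne
  refine ENNReal.add_ne_top.mpr ⟨ENNReal.mul_ne_top (by norm_num) ?_, hkill⟩
  exact ne_top_of_le_ne_top
    (ENNReal.mul_ne_top (by norm_num) (ENNReal.add_ne_top.mpr ⟨hrow, hcol⟩)) hedge

lemma mul_sq_sub_le_energy (h : IsGraph b c) {f : X → ℝ} (hf : energy b c f ≠ ⊤) (x y : X) :
    b x y * (f x - f y) ^ 2 ≤ 2 * (energy b c f).toReal := by
  have hle : ENNReal.ofReal (b x y * (f x - f y) ^ 2) ≤ 2 * energy b c f := by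
    calc ENNReal.ofReal (b x y * (f x - f y) ^ 2)
        ≤ ∑' p : X × X, ENNReal.ofReal (b p.1 p.2 * (f p.1 - f p.2) ^ 2) :=
          ENNReal.le_tsum (f := fun p : X × X =>
            ENNReal.ofReal (b p.1 p.2 * (f p.1 - f p.2) ^ 2)) (x, y)
      _ = 2 * ((1 / 2) * ∑' p : X × X, ENNReal.ofReal (b p.1 p.2 * (f p.1 - f p.2) ^ 2)) := by
          rw [← mul_assoc, one_div, ENNReal.mul_inv_cancel (by norm_num) (by norm_num), one_mul]
      _ ≤ 2 * energy b c f := mul_le_mul_right le_self_add _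
  have := ENNReal.toReal_mono (ENNReal.mul_ne_top (by norm_num) hf) hle
  rwa [ENNReal.toReal_ofReal (mul_nonneg (h.nonneg x y) (sq_nonneg _)), ENNReal.toReal_mul,
    ENNReal.toReal_ofNat] at this

lemma exists_abs_sub_le_sqrt_energy (h : IsGraph b c) (hconn : Connected b) (o x : X) :
    ∃ K : ℝ, 0 ≤ K ∧ ∀ f : X → ℝ, energy b c f ≠ ⊤ →
      |f x - f o| ≤ K * √(energy b c f).toReal := by
  induction hconn o x with
  | refl => exact ⟨0, le_rfl, fun f _ => by simp⟩
  | @tail y z _ hyz ih =>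
    obtain ⟨K, hK, hbound⟩ := ih
    refine ⟨√(2 / b y z) + K, by positivity, fun f hf => ?_⟩
    have hstep : |f z - f y| ≤ √(2 / b y z) * √(energy b c f).toReal := by
      rw [← Real.sqrt_mul (by positivity)]
      refine Real.abs_le_sqrt ?_
      have := mul_sq_sub_le_energy h hf y z
      rw [div_mul_eq_mul_div, le_div_iff₀ hyz]
      nlinarith
    calc |f z - f o| ≤ |f z - f y| + |f y - f o| := abs_sub_le _ _ _
      _ ≤ _ := by rw [add_mul]; exact add_le_add hstep (hbound f hf)

lemma FinSupp.smul {f : X → ℝ} (hf : FinSupp f) (a : ℝ) : FinSupp (a • f) :=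
  hf.subset (Function.support_const_smul_subset a f)

lemma FinSupp.sub {f g : X → ℝ} (hf : FinSupp f) (hg : FinSupp g) : FinSupp (f - g) :=
  (hf.union hg).subset (Function.support_sub f g)

lemma FinSupp.abs {f : X → ℝ} (hf : FinSupp f) : FinSupp |f| :=
  hf.subset fun x hx => by simpa using hx

lemma FinSupp.sum_range {f : ℕ → X → ℝ} (hf : ∀ n, FinSupp (f n)) (n : ℕ) :
    FinSupp (∑ i ∈ Finset.range n, f i) := by
  induction n with
  | zero => simp [FinSupp]
  | succ n ih =>
    rw [Finset.sum_range_succ]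
    exact (ih.union (hf n)).subset (Function.support_add _ _)

lemma toReal_energy_sub_le (h : IsGraph b c) {f g : X → ℝ} (hf : FinSupp f) (hg : FinSupp g) :
    (energy b c (f - g)).toReal ≤ 2 * ((energy b c f).toReal + (energy b c g).toReal) := by
  have hft := hf.energy_ne_top h
  have hgt := hg.energy_ne_top h
  have := ENNReal.toReal_mono (ENNReal.mul_ne_top (by norm_num)
    (ENNReal.add_ne_top.mpr ⟨hft, hgt⟩)) (energy_sub_le h f g)
  rwa [ENNReal.toReal_mul, ENNReal.toReal_add hft hgt, ENNReal.toReal_ofNat] at this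

/-- Under the sup-norm inequality for `‖·‖_o`, the capacity of `o` is positive. -/
lemma exists_le_energy_of_apply_eq_one [Infinite X] (h : IsGraph b c) (hconn : Connected b)
    {o : X} {C : ℝ} (hC : 0 ≤ C)
    (hbound : ∀ φ : X → ℝ, FinSupp φ → ∀ x : X, |φ x| ≤ C * normO b c o φ) :
    ∃ δ : ℝ, 0 < δ ∧ ∀ φ : X → ℝ, FinSupp φ → φ o = 1 → δ ≤ (energy b c φ).toReal := by
  by_contra! hsmall
  obtain ⟨φ, hφ, hφo, hφe⟩ := hsmall (1 / (16 * (C + 1) ^ 2)) (by positivity)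
  obtain ⟨x, hx⟩ := hφ.infinite_compl.nonempty
  have hφx : φ x = 0 := by simpa using hx
  obtain ⟨K, hK, hKbound⟩ := exists_abs_sub_le_sqrt_energy (c := c) h hconn o x
  obtain ⟨ψ, hψ, hψo, hψe⟩ := hsmall (min (1 / (16 * (C + 1) ^ 2)) (1 / (16 * (K + 1) ^ 2)))
    (by positivity)
  obtain ⟨hψe₁, hψe₂⟩ := lt_min_iff.mp hψe
  have hnear : |ψ x - 1| ≤ 1 / 4 := by
    have hs : √(energy b c ψ).toReal ≤ 1 / (4 * (K + 1)) := by
      refine Real.sqrt_le_iff.mpr ⟨by positivity, hψe₂.le.trans_eq ?_⟩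
      field_simp
      norm_num
    calc |ψ x - 1| ≤ K * √(energy b c ψ).toReal := by
          rw [← hψo]; exact hKbound ψ (hψ.energy_ne_top h)
      _ ≤ K * (1 / (4 * (K + 1))) := by gcongr
      _ ≤ 1 / 4 := by
          rw [mul_one_div, div_le_div_iff₀ (by positivity) (by norm_num)]
          linarith
  have hfar : |ψ x| ≤ 1 / 2 := by
    have hs : normO b c o (ψ - φ) ≤ 1 / (2 * (C + 1)) := by
      refine Real.sqrt_le_iff.mpr ⟨by positivity, ?_⟩
      have hsub := toReal_energy_sub_le h hψ hφ
      have : (1 / (2 * (C + 1))) ^ 2 = 4 * (1 / (16 * (C + 1) ^ 2)) := by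
        field_simp
        norm_num
      rw [this]
      simp only [Pi.sub_apply, hψo, hφo]
      linarith
    calc |ψ x| = |(ψ - φ) x| := by simp [hφx]
      _ ≤ C * normO b c o (ψ - φ) := hbound _ (hψ.sub hφ) x
      _ ≤ C * (1 / (2 * (C + 1))) := by gcongr
      _ ≤ 1 / 2 := by
          rw [mul_one_div, div_le_div_iff₀ (by positivity) (by norm_num)]
          linarith
  linarith [(abs_le.mp hnear).1, (abs_le.mp hfar).2]

lemma exists_abs_le_sqrt_energy_of_normO [Infinite X] (h : IsGraph b c) (hconn : Connected b)
    {o : X} {C : ℝ} (hC : 0 ≤ C)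
    (hbound : ∀ φ : X → ℝ, FinSupp φ → ∀ x : X, |φ x| ≤ C * normO b c o φ) :
    ∃ C' : ℝ, 0 ≤ C' ∧ ∀ φ : X → ℝ, FinSupp φ → ∀ x : X,
      |φ x| ≤ C' * √(energy b c φ).toReal := by
  obtain ⟨δ, hδ, hcap⟩ := exists_le_energy_of_apply_eq_one h hconn hC hbound
  have hpoint (φ : X → ℝ) (hφ : FinSupp φ) : φ o ^ 2 ≤ (energy b c φ).toReal / δ := by
    rcases eq_or_ne (φ o) 0 with h0 | h0
    · rw [h0, zero_pow two_ne_zero]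
      positivity
    · have := hcap ((φ o)⁻¹ • φ) (hφ.smul _) (by simp [h0])
      rw [energy_smul, ENNReal.toReal_mul, ENNReal.toReal_ofReal (sq_nonneg _), inv_pow,
        inv_mul_eq_div, le_div_iff₀ (by positivity)] at this
      rw [le_div_iff₀ hδ]
      linarith
  refine ⟨C * √(1 + 1 / δ), by positivity, fun φ hφ x => (hbound φ hφ x).trans ?_⟩
  rw [mul_assoc, ← Real.sqrt_mul (by positivity)]
  refine mul_le_mul_of_nonneg_left (Real.sqrt_le_sqrt ?_) hC
  have := hpoint φ hφ
  rw [add_mul, one_mul, one_div_mul_eq_div]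
  linarith

lemma uniformlyTransient_of_abs_le_sqrt_energy (h : IsGraph b c) {C : ℝ} (hC : 0 ≤ C)
    (hbound : ∀ φ : X → ℝ, FinSupp φ → ∀ x : X, |φ x| ≤ C * √(energy b c φ).toReal) :
    UniformlyTransient b c := by
  rintro f ⟨φ, hφ, hlim, henergy⟩ ε hε
  set η : ℝ := (ε / (2 * (C + 1))) ^ 2 / 4 with hη
  have hηpos : 0 < η := by positivity
  obtain ⟨N, hN⟩ := eventually_atTop.mp
    (henergy.eventually_le_const (ENNReal.ofReal_pos.mpr hηpos))
  have hclose (n : ℕ) (hn : N ≤ n) (x : X) : |φ n x - φ N x| ≤ ε / 2 := by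
    have he : energy b c (φ n - φ N) ≤ ENNReal.ofReal (4 * η) := by
      calc energy b c (φ n - φ N) = energy b c ((φ n - f) - (φ N - f)) := by
            rw [sub_sub_sub_cancel_right]
        _ ≤ 2 * (energy b c (φ n - f) + energy b c (φ N - f)) := energy_sub_le h _ _
        _ ≤ 2 * (ENNReal.ofReal η + ENNReal.ofReal η) := by gcongr <;> apply hN <;> grind
        _ = ENNReal.ofReal (4 * η) := by
            rw [← ENNReal.ofReal_add hηpos.le hηpos.le, ← ENNReal.ofReal_ofNat 2,
              ← ENNReal.ofReal_mul (by norm_num)]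
            congr 1
            ring
    have hs : √(energy b c (φ n - φ N)).toReal ≤ ε / (2 * (C + 1)) := by
      refine Real.sqrt_le_iff.mpr ⟨by positivity, ?_⟩
      refine (ENNReal.toReal_le_of_le_ofReal (by positivity) he).trans_eq ?_
      rw [hη]
      ring
    calc |φ n x - φ N x| ≤ C * √(energy b c (φ n - φ N)).toReal :=
          hbound _ ((hφ n).sub (hφ N)) x
      _ ≤ C * (ε / (2 * (C + 1))) := by gcongr
      _ ≤ ε / 2 := by
          rw [mul_div_assoc', div_le_div_iff₀ (by positivity) (by norm_num)]
          nlinarith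
  refine (hφ N).subset fun x hx => ?_
  rw [Function.mem_support]
  intro h0
  have hx' : ε ≤ |f x| := hx
  have : |f x - φ N x| ≤ ε / 2 :=
    le_of_tendsto ((hlim x).sub_const (φ N x)).abs
      (eventually_atTop.mpr ⟨N, fun n hn => hclose n hn x⟩)
  rw [h0, sub_zero] at this
  linarith

/-- If the sup-norm inequality for `‖·‖_o` fails, there are nonnegative finitely supported
functions of arbitrarily small `‖·‖_o`-norm and arbitrarily large sup-norm. -/
lemma exists_small_normO_large_value (h : IsGraph b c) {o : X}
    (hfail : ¬ ∃ C : ℝ, 0 ≤ C ∧ ∀ φ : X → ℝ, FinSupp φ → ∀ x : X, |φ x| ≤ C * normO b c o φ)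
    {R ε : ℝ} (hR : 0 < R) (hε : 0 < ε) :
    ∃ ψ : X → ℝ, FinSupp ψ ∧ 0 ≤ ψ ∧ energy b c ψ ≤ ENNReal.ofReal (ε ^ 2) ∧ ψ o ≤ ε ∧
      ∃ x, R ≤ ψ x := by
  push Not at hfail
  obtain ⟨φ, hφ, x, hx⟩ := hfail (R / ε) (by positivity)
  have hN : 0 ≤ normO b c o φ := Real.sqrt_nonneg _
  have hpos : 0 < |φ x| := lt_of_le_of_lt (by positivity) hx
  set a := R / |φ x| with ha
  have hapos : 0 < a := by positivity
  have haN : a * normO b c o φ ≤ ε := by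
    rw [div_mul_eq_mul_div, div_lt_iff₀ hε] at hx
    rw [ha, div_mul_eq_mul_div, div_le_iff₀ hpos]
    linarith
  have hsq : a ^ 2 * ((energy b c φ).toReal + φ o ^ 2) ≤ ε ^ 2 := by
    have := pow_le_pow_left₀ (by positivity) haN 2
    rwa [mul_pow, normO, Real.sq_sqrt (by positivity)] at this
  refine ⟨a • |φ|, hφ.abs.smul a, smul_nonneg hapos.le (abs_nonneg φ), ?_, ?_, x, ?_⟩
  · calc energy b c (a • |φ|) ≤ ENNReal.ofReal (a ^ 2) * energy b c φ := by
          rw [energy_smul]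
          gcongr
          exact energy_abs_le h φ
      _ = ENNReal.ofReal (a ^ 2 * (energy b c φ).toReal) := by
          rw [ENNReal.ofReal_mul (by positivity), ENNReal.ofReal_toReal (hφ.energy_ne_top h)]
      _ ≤ ENNReal.ofReal (ε ^ 2) := by
          apply ENNReal.ofReal_le_ofReal
          nlinarith [mul_nonneg (sq_nonneg a) (sq_nonneg (φ o))]
  · refine le_of_abs_le (abs_le_of_sq_le_sq ?_ hε.le)
    simp only [Pi.smul_apply, Pi.abs_apply, smul_eq_mul, mul_pow, sq_abs]
    nlinarith [mul_nonneg (sq_nonneg a) (ENNReal.toReal_nonneg (a := energy b c φ))]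
  · simp [ha, hpos.ne']

lemma energy_sum_range_le (h : IsGraph b c) {ψ : ℕ → X → ℝ}
    (hψ : ∀ n, energy b c (ψ n) ≤ ENNReal.ofReal (((1 / 4) ^ n) ^ 2)) (k N : ℕ) :
    energy b c (∑ i ∈ Finset.range k, ψ (N + i)) ≤ ENNReal.ofReal (4 * ((1 / 4) ^ N) ^ 2) := by
  induction k generalizing N with
  | zero => simp [energy]
  | succ k ih =>
    rw [Finset.sum_range_succ']
    have hshift : ∑ i ∈ Finset.range k, ψ (N + (i + 1)) =
        ∑ i ∈ Finset.range k, ψ (N + 1 + i) :=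
      Finset.sum_congr rfl fun i _ => by rw [add_assoc, add_comm 1 i]
    rw [hshift]
    calc energy b c (∑ i ∈ Finset.range k, ψ (N + 1 + i) + ψ (N + 0))
        ≤ 2 * (energy b c (∑ i ∈ Finset.range k, ψ (N + 1 + i)) + energy b c (ψ (N + 0))) :=
          energy_add_le h _ _
      _ ≤ 2 * (ENNReal.ofReal (4 * ((1 / 4) ^ (N + 1)) ^ 2) +
            ENNReal.ofReal (((1 / 4) ^ N) ^ 2)) := by
          gcongr
          · exact ih _
          · exact hψ N
      _ ≤ ENNReal.ofReal (4 * ((1 / 4) ^ N) ^ 2) := by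
          rw [← ENNReal.ofReal_add (by positivity) (by positivity), ← ENNReal.ofReal_ofNat 2,
            ← ENNReal.ofReal_mul (by norm_num)]
          apply ENNReal.ofReal_le_ofReal
          rw [pow_succ (1 / 4 : ℝ) N]
          nlinarith [sq_nonneg ((1 / 4 : ℝ) ^ N)]

lemma MemC0.bddAbove {f : X → ℝ} (hf : MemC0 f) : ∃ M : ℝ, ∀ x, f x ≤ M := by
  obtain ⟨M, hM⟩ := ((hf 1 one_pos).image f).bddAbove
  refine ⟨max M 1, fun x => ?_⟩
  by_cases hx : 1 ≤ |f x|
  · exact le_max_of_le_left (hM ⟨x, hx, rfl⟩)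
  · exact le_max_of_le_right ((le_abs_self _).trans (not_le.mp hx).le)

lemma UniformlyTransient.exists_abs_le_normO (h : IsGraph b c) (hconn : Connected b)
    (htrans : UniformlyTransient b c) (o : X) :
    ∃ C : ℝ, 0 ≤ C ∧ ∀ φ : X → ℝ, FinSupp φ → ∀ x : X, |φ x| ≤ C * normO b c o φ := by
  by_contra hfail
  choose ψ hfin hnonneg henergy hval hlarge using fun n : ℕ =>
    exists_small_normO_large_value h hfail (R := (n : ℝ) + 1) (ε := (1 / 4) ^ n)
      (by positivity) (by positivity)
  have hsummable (x : X) : Summable fun n => ψ n x := by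
    obtain ⟨K, hK, hKbound⟩ := exists_abs_sub_le_sqrt_energy (c := c) h hconn o x
    refine Summable.of_nonneg_of_le (fun n => hnonneg n x) (fun n => ?_)
      ((summable_geometric_of_lt_one (r := (1 / 4 : ℝ)) (by norm_num)
        (by norm_num)).mul_left (K + 1))
    have hs : √(energy b c (ψ n)).toReal ≤ (1 / 4) ^ n :=
      Real.sqrt_le_iff.mpr ⟨by positivity,
        ENNReal.toReal_le_of_le_ofReal (by positivity) (henergy n)⟩
    have hdiff := (abs_le.mp (hKbound (ψ n) ((hfin n).energy_ne_top h))).2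
    have := mul_le_mul_of_nonneg_left hs hK
    linarith [hval n]
  set f : X → ℝ := fun x => ∑' n, ψ n x
  have hpartial : Tendsto (fun n => ∑ i ∈ Finset.range n, ψ i) atTop (𝓝 f) := by
    rw [tendsto_pi_nhds]
    intro x
    simpa only [Finset.sum_apply] using (hsummable x).hasSum.tendsto_sum_nat
  have hmem : MemD0 b c f := by
    refine ⟨fun n => ∑ i ∈ Finset.range n, ψ i, FinSupp.sum_range hfin,
      tendsto_pi_nhds.mp hpartial, ?_⟩
    have hgeom : Tendsto (fun N : ℕ => ENNReal.ofReal (4 * ((1 / 4) ^ N) ^ 2)) atTop (𝓝 0) := by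
      have h0 : Tendsto (fun N : ℕ => (1 / 4 : ℝ) ^ N) atTop (𝓝 0) :=
        tendsto_pow_atTop_nhds_zero_of_lt_one (by norm_num) (by norm_num)
      simpa using ENNReal.tendsto_ofReal ((h0.pow 2).const_mul 4)
    refine tendsto_of_tendsto_of_tendsto_of_le_of_le tendsto_const_nhds hgeom
      (fun _ => zero_le) fun N => ?_
    rw [← energy_neg, neg_sub]
    refine energy_le_of_tendsto (f := fun k => ∑ i ∈ Finset.range k, ψ (N + i)) ?_
      fun k => energy_sum_range_le h henergy k N
    have hshift := (hpartial.comp (tendsto_add_atTop_nat N)).sub_const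
      (∑ i ∈ Finset.range N, ψ i)
    refine hshift.congr fun k => ?_
    simp only [Function.comp_apply]
    rw [add_comm k N, Finset.sum_range_add, add_sub_cancel_left]
  obtain ⟨M, hM⟩ := (htrans f hmem).bddAbove
  obtain ⟨n, hn⟩ := exists_nat_gt M
  obtain ⟨x, hx⟩ := hlarge n
  have : ψ n x ≤ f x := (hsummable x).le_tsum n fun i _ => hnonneg i x
  linarith [hM x]

end UTGraph

open UTGraph Filter Topology ENNReal in
/-- uniform transience `D₀ ⊆ C₀(X)` is equivalent to the sup-norm
isoperimetric inequality `‖φ‖_∞ ≤ C Q(φ)^{1/2}` on `C_c(X)`, which is equivalent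
to `‖φ‖_∞ ≤ C_o ‖φ‖_o` on `C_c(X)` for all `o`, which holds for all `o` iff it
holds for one `o`. -/
theorem stmt4 {X : Type*} [Countable X] [Infinite X]
    (b : X → X → ℝ) (c : X → ℝ) (hgraph : IsGraph b c) (hconn : Connected b) :
    (UniformlyTransient b c ↔
      ∃ C : ℝ, 0 ≤ C ∧ ∀ φ : X → ℝ, FinSupp φ → ∀ x : X,
        |φ x| ≤ C * Real.sqrt (energy b c φ).toReal) ∧
    ((∃ C : ℝ, 0 ≤ C ∧ ∀ φ : X → ℝ, FinSupp φ → ∀ x : X,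
        |φ x| ≤ C * Real.sqrt (energy b c φ).toReal) ↔
      (∀ o : X, ∃ Co : ℝ, 0 ≤ Co ∧ ∀ φ : X → ℝ, FinSupp φ → ∀ x : X,
        |φ x| ≤ Co * normO b c o φ)) ∧
    ((∀ o : X, ∃ Co : ℝ, 0 ≤ Co ∧ ∀ φ : X → ℝ, FinSupp φ → ∀ x : X,
        |φ x| ≤ Co * normO b c o φ) ↔
      (∃ o : X, ∃ Co : ℝ, 0 ≤ Co ∧ ∀ φ : X → ℝ, FinSupp φ → ∀ x : X,
        |φ x| ≤ Co * normO b c o φ)) := by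
  have hnormO : (∃ C : ℝ, 0 ≤ C ∧ ∀ φ : X → ℝ, FinSupp φ → ∀ x : X,
        |φ x| ≤ C * Real.sqrt (energy b c φ).toReal) →
      ∀ o : X, ∃ Co : ℝ, 0 ≤ Co ∧ ∀ φ : X → ℝ, FinSupp φ → ∀ x : X,
        |φ x| ≤ Co * normO b c o φ := by
    rintro ⟨C, hC, hbound⟩ o
    refine ⟨C, hC, fun φ hφ x => (hbound φ hφ x).trans ?_⟩
    exact mul_le_mul_of_nonneg_left
      (Real.sqrt_le_sqrt (le_add_of_nonneg_right (sq_nonneg _))) hC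
  have hsome : (∃ o : X, ∃ Co : ℝ, 0 ≤ Co ∧ ∀ φ : X → ℝ, FinSupp φ → ∀ x : X,
        |φ x| ≤ Co * normO b c o φ) →
      ∃ C : ℝ, 0 ≤ C ∧ ∀ φ : X → ℝ, FinSupp φ → ∀ x : X,
        |φ x| ≤ C * Real.sqrt (energy b c φ).toReal := by
    rintro ⟨o, C, hC, hbound⟩
    exact exists_abs_le_sqrt_energy_of_normO hgraph hconn hC hbound
  obtain ⟨o⟩ : Nonempty X := inferInstance
  refine ⟨⟨fun htrans => hsome ⟨o, htrans.exists_abs_le_normO hgraph hconn o⟩, ?_⟩,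
    ⟨hnormO, fun hall => hsome ⟨o, hall o⟩⟩,
    ⟨fun hall => ⟨o, hall o⟩, fun hone => hnormO (hsome hone)⟩⟩
  rintro ⟨C, hC, hbound⟩
  exact uniformlyTransient_of_abs_le_sqrt_energy hgraph hC hbound
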